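/- Let α ∈ ℝ and let A, B, C : ℝ → ℂ be continuous 1-periodic functions with A(θ) ≠ 0 for every θ. Then there exist continuous 1-periodic functions u₁, u₂, 𝒞 : ℝ → ℂ with u₁(θ) ≠ 0 for every θ, such that for all θ ∈ ℝ and all z ∈ ℂ: u₁(θ+α)·(A(θ)z² + B(θ)z + C(θ)) + u₂(θ+α) = (u₁(θ)z + u₂(θ))² + 𝒞(θ). Equivalently, every fibred quadratic polynomial (θ,z) ↦ (θ+α, A(θ)z² + B(θ)z + C(θ)) is conjugated, by a fibred transformation W(θ,z) = (θ, u₁(θ)z + u₂(θ)) affine on each fiber, to one of the normal form (θ,z) ↦ (θ+α, z² + 𝒞(θ)). -/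

import Mathlib

open Complex in
/-- A continuous nowhere vanishing periodic function has a continuous logarithm, which is periodic
up to an integer multiple of `2πi`. -/
theorem exists_continuous_log_of_periodic {A : ℝ → ℂ} (hA : Continuous A)
    (hAper : Function.Periodic A 1) (hA0 : ∀ θ, A θ ≠ 0) :
    ∃ (L : ℝ → ℂ) (d : ℤ), Continuous L ∧ (∀ θ, exp (L θ) = A θ) ∧
      ∀ θ, L (θ + 1) = L θ + d * (2 * Real.pi * I) := by
  have lifts (e : ℂ) (he : exp e = A 0) :=
    isCoveringMapOn_exp.existsUnique_continuousMap_lifts (⟨A, hA⟩ : C(ℝ, ℂ)) he hA0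
  obtain ⟨L, ⟨-, hL⟩, -⟩ := lifts (log (A 0)) (exp_log (hA0 0))
  replace hL (θ : ℝ) : exp (L θ) = A θ := congrFun hL θ
  have h01 : exp (L 1) = exp (L 0) := by
    rw [hL, hL]
    simpa using hAper 0
  obtain ⟨d, hd⟩ := exp_eq_exp_iff_exists_int.1 h01
  have hshift : (⟨fun θ ↦ L (θ + 1), by fun_prop⟩ : C(ℝ, ℂ)) =
      ⟨fun θ ↦ L θ + d * (2 * Real.pi * I), by fun_prop⟩ := by
    refine (lifts (L 1) (h01.trans (hL 0))).unique ⟨by simp, ?_⟩ ⟨by simp [hd], ?_⟩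
    · ext θ
      simp [hL, hAper θ]
    · ext θ
      simp [exp_add, exp_int_mul_two_pi_mul_I, hL]
  exact ⟨L, d, L.continuous, hL, fun θ ↦ congr($hshift θ)⟩

/-- For a continuous periodic `b`, the twisted cohomological equation
`v (θ + α) + b θ = 2 * v θ` has a continuous periodic solution. -/
theorem exists_periodic_solution_twisted_cohomological (α : ℝ) {b : ℝ → ℂ} (hb : Continuous b)
    (hbper : Function.Periodic b 1) :
    ∃ v : ℝ → ℂ, Continuous v ∧ Function.Periodic v 1 ∧ ∀ θ, v (θ + α) + b θ = 2 * v θ := by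
  obtain ⟨M, hM⟩ := (hbper.isBounded_of_continuous one_ne_zero hb).exists_norm_le
  have hbound (n : ℕ) (θ : ℝ) : ‖(1 / 2 : ℂ) ^ n * (b (θ + n * α) / 2)‖ ≤ (1 / 2) ^ n * M := by
    have h := hM _ (Set.mem_range_self (θ + n * α))
    rw [norm_mul, norm_pow, norm_div, norm_div, norm_one, RCLike.norm_ofNat]
    gcongr
    linarith [norm_nonneg (b (θ + n * α))]
  have hsum : Summable fun n : ℕ ↦ (1 / 2 : ℝ) ^ n * M := summable_geometric_two.mul_right M
  refine ⟨fun θ ↦ ∑' n : ℕ, (1 / 2 : ℂ) ^ n * (b (θ + n * α) / 2),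
    continuous_tsum (fun n ↦ by fun_prop) hsum hbound, fun θ ↦ ?_, fun θ ↦ ?_⟩
  · refine tsum_congr fun n ↦ ?_
    rw [add_right_comm, hbper]
  · have hs : Summable fun n : ℕ ↦ (1 / 2 : ℂ) ^ n * (b (θ + n * α) / 2) :=
      .of_norm_bounded hsum fun n ↦ hbound n θ
    have hstep (n : ℕ) : (1 / 2 : ℂ) ^ (n + 1) * (b (θ + (n + 1 : ℕ) * α) / 2) =
        (1 / 2) * ((1 / 2 : ℂ) ^ n * (b (θ + α + n * α) / 2)) := by
      have : θ + (n + 1 : ℕ) * α = θ + α + n * α := by push_cast; ring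
      rw [this]
      ring
    simp only [hs.tsum_eq_zero_add, hstep, tsum_mul_left]
    simp only [pow_zero, Nat.cast_zero, zero_mul, add_zero]
    ring

open Complex in
/-- For a continuous nowhere vanishing periodic `A`, the equation `u (θ + α) * A θ = u θ ^ 2`
has a continuous nowhere vanishing periodic solution. -/
theorem exists_periodic_mul_eq_sq (α : ℝ) {A : ℝ → ℂ} (hA : Continuous A)
    (hAper : Function.Periodic A 1) (hA0 : ∀ θ, A θ ≠ 0) :
    ∃ u : ℝ → ℂ, Continuous u ∧ Function.Periodic u 1 ∧ (∀ θ, u θ ≠ 0) ∧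
      ∀ θ, u (θ + α) * A θ = u θ ^ 2 := by
  obtain ⟨L, d, hLc, hL, hLd⟩ := exists_continuous_log_of_periodic hA hAper hA0
  obtain ⟨v, hvc, hvper, hv⟩ := exists_periodic_solution_twisted_cohomological α
    (b := fun θ ↦ L θ - d * (2 * Real.pi * I) * θ + d * (2 * Real.pi * I) * α) (by fun_prop)
    (fun θ ↦ by simp only [hLd]; push_cast; ring)
  refine ⟨fun θ ↦ exp (d * (2 * Real.pi * I) * θ + v θ), by fun_prop, fun θ ↦ ?_,
    fun θ ↦ exp_ne_zero _, fun θ ↦ ?_⟩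
  · refine exp_eq_exp_iff_exists_int.2 ⟨d, ?_⟩
    rw [hvper θ]
    push_cast
    ring
  · simp only [← hL θ, ← exp_add, ← exp_nat_mul]
    congr 1
    push_cast
    linear_combination hv θ


/-- Every fibred quadratic polynomial `(θ, z) ↦ (θ + α, A θ * z² + B θ * z + C θ)`
is conjugated, by a fibred transformation affine on each fiber
`W (θ, z) = (θ, u₁ θ * z + u₂ θ)`, to the normal form `(θ, z) ↦ (θ + α, z² + 𝒞 θ)`. -/
theorem fibred_quadratic_normal_form
    (α : ℝ) (A B C : ℝ → ℂ)
    (hA : Continuous A) (hAper : Function.Periodic A 1)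
    (hB : Continuous B) (hBper : Function.Periodic B 1)
    (hC : Continuous C) (hCper : Function.Periodic C 1)
    (hA0 : ∀ θ, A θ ≠ 0) :
    ∃ u₁ u₂ 𝒞 : ℝ → ℂ,
      Continuous u₁ ∧ Function.Periodic u₁ 1 ∧
      Continuous u₂ ∧ Function.Periodic u₂ 1 ∧
      Continuous 𝒞 ∧ Function.Periodic 𝒞 1 ∧
      (∀ θ, u₁ θ ≠ 0) ∧
      (∀ θ z, u₁ (θ + α) * (A θ * z ^ 2 + B θ * z + C θ) + u₂ (θ + α)
          = (u₁ θ * z + u₂ θ) ^ 2 + 𝒞 θ) := by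
  obtain ⟨u, hu, huper, hu0, hueq⟩ := exists_periodic_mul_eq_sq α hA hAper hA0
  have huα : Function.Periodic (fun θ ↦ u (θ + α)) 1 := fun θ ↦ by
    simp only [add_right_comm θ 1 α, huper (θ + α)]
  set w : ℝ → ℂ := fun θ ↦ u (θ + α) * B θ / (2 * u θ) with hw
  have hwc : Continuous w :=
    .div (by fun_prop) (by fun_prop) fun θ ↦ mul_ne_zero two_ne_zero (hu0 θ)
  have hwper : Function.Periodic w 1 := fun θ ↦ by
    simp only [hw, huα θ, hBper θ, huper θ]
  have hwα : Function.Periodic (fun θ ↦ w (θ + α)) 1 := fun θ ↦ by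
    simp only [add_right_comm θ 1 α, hwper (θ + α)]
  have hweq (θ : ℝ) : u (θ + α) * B θ = 2 * u θ * w θ :=
    (mul_div_cancel₀ _ (mul_ne_zero two_ne_zero (hu0 θ))).symm
  refine ⟨u, w, fun θ ↦ u (θ + α) * C θ + w (θ + α) - w θ ^ 2, hu, huper, hwc, hwper,
    by fun_prop, fun θ ↦ ?_, hu0, fun θ z ↦ ?_⟩
  · simp only [huα θ, hCper θ, hwα θ, hwper θ]
  · linear_combination z ^ 2 * hueq θ + z * hweq θ
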